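/- Let n ≥ 1 be a natural number and let F : ℕ → ℕ → ℤ satisfy F_r(0) = 1 for all r and F_r(k) = (2^n - r - k)·F_r(k-1) + 4·(2^n - 2r - 1)·F_{r+1}(k-1) whenever k ≥ 1 and r + k ≤ 2^{n-1}. Then F_0(2^{n-1}) = (2^{2^n} + 1) · ∏_{j=1}^{2^{n-1}}(2^n - j); that is, the Fermat number 2^{2^n} + 1 equals F_0(2^{n-1}) divided by (2^n - 1)(2^n - 2)⋯(2^{n-1}). -/

import Mathlib

open Finset in
/-- The even-indexed Jacobsthal numbers as a diagonal sum of binomial coefficients, together with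
the odd-indexed ones. -/
theorem three_mul_sum_two_pow_mul_choose (h : ℕ) :
    3 * ∑ p ∈ antidiagonal h, 2 ^ p.1 * (2 * p.2 + p.1).choose p.1 = 2 * 4 ^ h + 1 ∧
    3 * ∑ p ∈ antidiagonal h, 2 ^ p.1 * (2 * p.2 + 1 + p.1).choose p.1 + 1 = 4 * 4 ^ h := by
  induction h with
  | zero => simp
  | succ h ih =>
    obtain ⟨he, ho⟩ := ih
    have even_step : ∑ p ∈ antidiagonal (h + 1), 2 ^ p.1 * (2 * p.2 + p.1).choose p.1 =
        ∑ p ∈ antidiagonal h, 2 ^ p.1 * (2 * p.2 + 1 + p.1).choose p.1 +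
        2 * ∑ p ∈ antidiagonal h, 2 ^ p.1 * (2 * p.2 + p.1).choose p.1 := by
      have shift : 1 + ∑ p ∈ antidiagonal h, 2 ^ (p.1 + 1) * (2 * p.2 + p.1).choose (p.1 + 1) =
          ∑ p ∈ antidiagonal h, 2 ^ p.1 * (2 * p.2 + 1 + p.1).choose p.1 := by
        have hfst := Nat.sum_antidiagonal_succ (n := h)
          (f := fun p : ℕ × ℕ => 2 ^ p.1 * (2 * p.2 + p.1 - 1).choose p.1)
        have hsnd := Nat.sum_antidiagonal_succ' (n := h)
          (f := fun p : ℕ × ℕ => 2 ^ p.1 * (2 * p.2 + p.1 - 1).choose p.1)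
        have odd_eq : ∀ i j : ℕ, 2 * (j + 1) + i - 1 = 2 * j + 1 + i := by omega
        rw [hfst] at hsnd
        simpa [odd_eq, ← add_assoc] using hsnd
      rw [Nat.sum_antidiagonal_succ, ← shift, mul_sum, add_assoc, ← sum_add_distrib]
      congr 1
      refine sum_congr rfl fun p _ => ?_
      simp only [← add_assoc, Nat.choose_succ_succ']
      ring
    have odd_step : ∑ p ∈ antidiagonal (h + 1), 2 ^ p.1 * (2 * p.2 + 1 + p.1).choose p.1 =
        ∑ p ∈ antidiagonal (h + 1), 2 ^ p.1 * (2 * p.2 + p.1).choose p.1 +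
        2 * ∑ p ∈ antidiagonal h, 2 ^ p.1 * (2 * p.2 + 1 + p.1).choose p.1 := by
      rw [Nat.sum_antidiagonal_succ, Nat.sum_antidiagonal_succ, mul_sum,
        add_assoc (2 ^ _ * _), ← sum_add_distrib]
      congr 1
      refine sum_congr rfl fun p _ => ?_
      simp only [← add_assoc, Nat.choose_succ_succ']
      rw [show 2 * p.2 + 1 + p.1 = 2 * p.2 + p.1 + 1 by ring, Nat.choose_succ_succ']
      ring
    rw [odd_step, even_step, pow_succ]
    omega

/-- The coefficients `(2j + 2i) / (2j + i) * choose (2j + i) i` of the Lucas polynomials. -/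
def lucasCoeff : ℕ → ℕ → ℕ
  | 0, _ => 1
  | i + 1, j => (2 * j + i + 1).choose (i + 1) + (2 * j + i).choose i

open Finset in
theorem sum_two_pow_mul_lucasCoeff (h : ℕ) :
    ∑ p ∈ antidiagonal (h + 1), 2 ^ p.1 * lucasCoeff p.1 p.2 = 4 ^ (h + 1) + 1 := by
  have split : ∑ p ∈ antidiagonal (h + 1), 2 ^ p.1 * lucasCoeff p.1 p.2 =
      ∑ p ∈ antidiagonal (h + 1), 2 ^ p.1 * (2 * p.2 + p.1).choose p.1 +
      2 * ∑ p ∈ antidiagonal h, 2 ^ p.1 * (2 * p.2 + p.1).choose p.1 := by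
    rw [Nat.sum_antidiagonal_succ, Nat.sum_antidiagonal_succ, mul_sum,
      add_assoc (2 ^ _ * _), ← sum_add_distrib]
    congr 1
    refine sum_congr rfl fun p _ => ?_
    simp only [lucasCoeff, ← add_assoc]
    ring
  have h1 := (three_mul_sum_two_pow_mul_choose (h + 1)).1
  have h2 := (three_mul_sum_two_pow_mul_choose h).1
  rw [split]
  rw [pow_succ] at h1 ⊢
  omega

open Nat in
theorem lucasCoeff_mul_factorial (i j g : ℕ) (hg : i + j = g + 1) :
    lucasCoeff i j * (i ! * (2 * j)!) = 2 * (g + 1) * (g + j)! := by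
  cases i with
  | zero =>
    obtain rfl : j = g + 1 := by omega
    rw [show g + (g + 1) = 2 * g + 1 by ring, show 2 * (g + 1) = 2 * g + 1 + 1 by ring,
      Nat.factorial_succ (2 * g + 1)]
    simp [lucasCoeff]
  | succ i =>
    obtain rfl : g = i + j := by omega
    have h1 := Nat.add_choose_mul_factorial_mul_factorial (2 * j) (i + 1)
    have h2 := Nat.add_choose_mul_factorial_mul_factorial (2 * j) i
    rw [lucasCoeff, show i + j + j = 2 * j + i by ring]
    rw [← add_assoc] at h1
    simp only [Nat.factorial_succ] at h1 ⊢
    linear_combination h1 + (i + 1) * h2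

open Finset Nat in
theorem prod_odd_mul_factorial (i j : ℕ) :
    (∏ s ∈ range i, (2 * ((i + j : ℕ) : ℤ) - 2 * s - 1)) * (2 ^ i * (i + j)! * (2 * j)!) =
      (2 * (i + j))! * j ! := by
  induction i with
  | zero => simp [mul_comm]
  | succ i ih =>
    rw [prod_range_succ']
    have shift : ∀ s : ℕ, 2 * ((i + 1 + j : ℕ) : ℤ) - 2 * ((s + 1 : ℕ) : ℤ) - 1 =
        2 * ((i + j : ℕ) : ℤ) - 2 * s - 1 := by
      intro s; push_cast; ring
    simp only [shift]
    rw [show i + 1 + j = i + j + 1 by ring,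
      show 2 * (i + j + 1) = 2 * (i + j) + 1 + 1 by ring]
    simp only [Nat.factorial_succ]
    push_cast at ih ⊢
    linear_combination (2 * ((i : ℤ) + j) + 2) * (2 * ((i : ℤ) + j) + 1) * ih

open Finset Nat in
theorem prod_add_mul_factorial (g j : ℕ) :
    (∏ t ∈ range j, ((g : ℤ) + 1 + t)) * g ! = (g + j)! := by
  induction j with
  | zero => simp
  | succ j ih =>
    rw [prod_range_succ, ← add_assoc, Nat.factorial_succ]
    push_cast
    linear_combination ((g : ℤ) + 1 + j) * ih

open Finset Nat in
theorem prod_Icc_sub_mul_factorial (g : ℕ) :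
    (∏ j ∈ Icc 1 ((g : ℤ) + 1), (2 * ((g : ℤ) + 1) - j)) * g ! = (2 * g + 1)! := by
  rw [show 2 * g + 1 = g + (g + 1) by ring, ← prod_add_mul_factorial]
  congr 1
  refine prod_nbij' (fun j => ((g : ℤ) + 1 - j).toNat) (fun t => (g : ℤ) + 1 - t) ?_ ?_ ?_ ?_ ?_ <;>
    simp only [mem_Icc, mem_range] <;> omega

open Finset in
/-- Unfolding the recurrence: the weight of a lattice path depends only on its numbers of steps of
each kind. -/
theorem recurrence_eq_sum (N : ℤ) (h : ℕ) (F : ℕ → ℕ → ℤ) (hF0 : ∀ r, F r 0 = 1)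
    (hF : ∀ r k, r + (k + 1) ≤ h → F r (k + 1) =
      (N - r - (k + 1)) * F r k + 4 * (N - 2 * r - 1) * F (r + 1) k) (k r : ℕ) (hrk : r + k ≤ h) :
    F r k = ∑ p ∈ antidiagonal k, (k.choose p.1 : ℤ) *
      (4 ^ p.1 * (∏ s ∈ range p.1, (N - 2 * r - 2 * s - 1)) *
        ∏ t ∈ range p.2, (N - r - k + t)) := by
  induction k generalizing r with
  | zero => simp [hF0]
  | succ k ih =>
    rw [hF r k hrk, ih r (by omega), ih (r + 1) (by omega),
      Finset.sum_antidiagonal_choose_succ_mul (fun i j : ℕ => 4 ^ i *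
        (∏ s ∈ range i, (N - 2 * r - 2 * s - 1)) * ∏ t ∈ range j, (N - r - (k + 1 : ℕ) + t)),
      mul_sum, mul_sum]
    congr 1
    · refine sum_congr rfl fun p _ => ?_
      have shift : ∀ t : ℕ, N - r - ((k + 1 : ℕ) : ℤ) + ((t + 1 : ℕ) : ℤ) = N - r - k + t := by
        intro t; push_cast; ring
      simp only [prod_range_succ' _ p.2, shift]
      push_cast
      ring
    · refine sum_congr rfl fun p hp => ?_
      have hsymm : k.choose p.2 = k.choose p.1 := by
        rw [← mem_antidiagonal.1 hp, Nat.choose_symm_add]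
      have shift : ∀ s : ℕ, N - 2 * r - 2 * ((s + 1 : ℕ) : ℤ) - 1 =
          N - 2 * ((r + 1 : ℕ) : ℤ) - 2 * s - 1 := by
        intro s; push_cast; ring
      have shift' : ∀ t : ℕ, N - ((r + 1 : ℕ) : ℤ) - k + t = N - r - ((k + 1 : ℕ) : ℤ) + t := by
        intro t; push_cast; ring
      simp only [prod_range_succ' _ p.1, shift, shift', hsymm]
      push_cast
      ring

open Finset Nat in
theorem path_weight_eq (i j g : ℕ) (hg : i + j = g + 1) :
    ((g + 1).choose i : ℤ) * (4 ^ i * (∏ s ∈ range i, (2 * ((g : ℤ) + 1) - 2 * s - 1)) *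
      ∏ t ∈ range j, ((g : ℤ) + 1 + t)) =
    (2 ^ i * lucasCoeff i j) * ∏ j ∈ Icc 1 ((g : ℤ) + 1), (2 * ((g : ℤ) + 1) - j) := by
  have hA := prod_odd_mul_factorial i j
  have hB := prod_add_mul_factorial g j
  have hP := prod_Icc_sub_mul_factorial g
  have hE : (lucasCoeff i j : ℤ) * (i ! * (2 * j)!) = 2 * (g + 1) * (g + j)! := by
    exact_mod_cast lucasCoeff_mul_factorial i j g hg
  have hC : ((g + 1).choose i : ℤ) * i ! * j ! = (g + 1)! := by
    have := Nat.add_choose_mul_factorial_mul_factorial i j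
    rw [← Nat.choose_symm_add, hg] at this
    exact_mod_cast this
  have hfac : ((2 * (g + 1))! : ℤ) = 2 * (g + 1) * (2 * g + 1)! := by
    rw [show 2 * (g + 1) = 2 * g + 1 + 1 by ring, Nat.factorial_succ]
    push_cast; ring
  rw [hg, hfac] at hA
  push_cast at hA
  have hne : ((i ! * j ! * (2 * j)! * g ! : ℕ) : ℤ) ≠ 0 := by positivity
  refine mul_right_cancel₀ hne ?_
  push_cast
  generalize (∏ s ∈ range i, (2 * ((g : ℤ) + 1) - 2 * s - 1)) = A at *
  generalize (∏ t ∈ range j, ((g : ℤ) + 1 + t)) = B at *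
  generalize (∏ j ∈ Icc 1 ((g : ℤ) + 1), (2 * ((g : ℤ) + 1) - j)) = P at *
  rw [show (4 : ℤ) ^ i = 2 ^ i * 2 ^ i by rw [← mul_pow]; norm_num]
  calc _ = 2 ^ i * (((g + 1).choose i : ℤ) * i ! * j !) * (A * (2 ^ i * (2 * j)!)) * (B * g !) := by
        ring
    _ = 2 ^ i * (A * (2 ^ i * (g + 1)! * (2 * j)!)) * (g + j)! := by rw [hC, hB]; ring
    _ = 2 ^ i * j ! * (2 * g + 1)! * (2 * (g + 1) * (g + j)!) := by rw [hA]; ring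
    _ = _ := by rw [← hE, ← hP]; ring

theorem omega_fermat_representation
    (n : ℕ) (hn : 1 ≤ n)
    (F : ℕ → ℕ → ℤ)
    (hF0 : ∀ r, F r 0 = 1)
    (hF : ∀ r k, 1 ≤ k → r + k ≤ 2 ^ (n - 1) →
      F r k = ((2 ^ n : ℤ) - r - k) * F r (k - 1)
        + 4 * ((2 ^ n : ℤ) - 2 * r - 1) * F (r + 1) (k - 1)) :
    F 0 (2 ^ (n - 1)) =
      (2 ^ (2 ^ n) + 1) * ∏ j ∈ Finset.Icc 1 (2 ^ (n - 1)), ((2 ^ n : ℤ) - j) := by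
  obtain ⟨g, hg⟩ : ∃ g, 2 ^ (n - 1) = g + 1 := Nat.exists_eq_add_one.2 (by positivity)
  have hN : 2 ^ n = 2 * (g + 1) := by rw [← hg, ← pow_succ', Nat.sub_add_cancel hn]
  have hNZ : (2 ^ n : ℤ) = 2 * ((g : ℤ) + 1) := by exact_mod_cast hN
  have hgZ : (2 ^ (n - 1) : ℤ) = (g : ℤ) + 1 := by exact_mod_cast hg
  rw [hg] at hF ⊢
  simp only [hNZ, hgZ] at hF ⊢
  rw [recurrence_eq_sum (2 * ((g : ℤ) + 1)) (g + 1) F hF0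
    (fun r k hrk => by simpa using hF r (k + 1) (by omega) hrk) (g + 1) 0 (by omega)]
  have hsum : (∑ p ∈ Finset.HasAntidiagonal.antidiagonal (g + 1), 2 ^ p.1 * (lucasCoeff p.1 p.2 : ℤ)) =
      2 ^ (2 ^ n) + 1 := by
    rw [hN, pow_mul]
    exact_mod_cast sum_two_pow_mul_lucasCoeff g
  rw [← hsum, Finset.sum_mul]
  refine Finset.sum_congr rfl fun p hp => ?_
  rw [← path_weight_eq p.1 p.2 g (Finset.HasAntidiagonal.mem_antidiagonal.1 hp)]
  have hdiff : 2 * ((g : ℤ) + 1) - ((g + 1 : ℕ) : ℤ) = g + 1 := by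
    push_cast; ring
  simp only [hdiff, Nat.cast_zero, mul_zero, sub_zero]
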